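/- arXiv:2405.18856 — 3 statements merged into one kernel-verified Lean document; each statement's English description precedes it below -/
import Mathlib

section
/- The new degrees-of-freedom-adjusted variance estimator dominates the unadjusted one exactly: V̂_nB(Y) − V̆_nB(Y) = −Σ_s (n(s)/n){σ̂²(Y,1,s)/n_1(s) + σ̂²(Y,0,s)/n_0(s)}, V̂_nW(Y) − V̆_nW(Y) = Σ_s (n(s)/n){(n(s)/n_1(s))·σ̂²(Y,1,s)/n_1(s) + (n(s)/n_0(s))·σ̂²(Y,0,s)/n_0(s)}, and hence V̂_τ̂ − V̆_τ̂ = Σ_s (n(s)/n){σ̂²(Y,1,s)·n_0(s)/n_1(s)² + σ̂²(Y,0,s)·n_1(s)/n_0(s)²} ≥ 0. -/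
noncomputable section

namespace VarCompare

/-- Number of units in stratum `s` (both arms). -/
def nStr (nA : Fin 2 → ℕ → ℕ) (s : ℕ) : ℕ := nA 0 s + nA 1 s

/-- Within-arm within-stratum sample mean of the observations `y a s 0, …`. -/
def sMean (nA : Fin 2 → ℕ → ℕ) (y : Fin 2 → ℕ → ℕ → ℝ) (a : Fin 2) (s : ℕ) : ℝ :=
  (∑ j ∈ Finset.range (nA a s), y a s j) / (nA a s : ℝ)

/-- Within-arm within-stratum sample second moment. -/
def sMu2 (nA : Fin 2 → ℕ → ℕ) (y : Fin 2 → ℕ → ℕ → ℝ) (a : Fin 2) (s : ℕ) : ℝ :=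
  (∑ j ∈ Finset.range (nA a s), (y a s j) ^ 2) / (nA a s : ℝ)

/-- Within-arm within-stratum sample variance with divisor `n_a(s) − 1`. -/
def sVar (nA : Fin 2 → ℕ → ℕ) (y : Fin 2 → ℕ → ℕ → ℝ) (a : Fin 2) (s : ℕ) : ℝ :=
  (∑ j ∈ Finset.range (nA a s), (y a s j - sMean nA y a s) ^ 2) / ((nA a s : ℝ) - 1)

/-- Stratified difference-in-means estimator `τ̂`. -/
def tauHat (𝒮 : Finset ℕ) (nA : Fin 2 → ℕ → ℕ) (y : Fin 2 → ℕ → ℕ → ℝ) (n : ℕ) : ℝ :=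
  ∑ s ∈ 𝒮, ((nStr nA s : ℝ) / (n : ℝ)) * (sMean nA y 1 s - sMean nA y 0 s)

/-- New (degrees-of-freedom-adjusted) between-stratum variance estimator `V̂_nB(Y)`. -/
def VhatB (𝒮 : Finset ℕ) (nA : Fin 2 → ℕ → ℕ) (y : Fin 2 → ℕ → ℕ → ℝ) (n : ℕ) : ℝ :=
  (∑ s ∈ 𝒮, ((nStr nA s : ℝ) / (n : ℝ)) * ∑ a : Fin 2, (sMu2 nA y a s - sVar nA y a s))
    - 2 * (∑ s ∈ 𝒮, ((nStr nA s : ℝ) / (n : ℝ)) * (sMean nA y 0 s * sMean nA y 1 s))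
    - (tauHat 𝒮 nA y n) ^ 2

/-- New within-stratum variance estimator `V̂_nW(Y)` (both arms summed). -/
def VhatW (𝒮 : Finset ℕ) (nA : Fin 2 → ℕ → ℕ) (y : Fin 2 → ℕ → ℕ → ℝ) (n : ℕ) : ℝ :=
  ∑ s ∈ 𝒮, ∑ a : Fin 2,
    ((nStr nA s : ℝ) / (n : ℝ)) * (((nStr nA s : ℝ) / (nA a s : ℝ)) * sVar nA y a s)

/-- Ma et al. (2022) between-stratum variance estimator `V̆_nB(Y)`. -/
def VbreveB (𝒮 : Finset ℕ) (nA : Fin 2 → ℕ → ℕ) (y : Fin 2 → ℕ → ℕ → ℝ) (n : ℕ) : ℝ :=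
  ∑ s ∈ 𝒮, ((nStr nA s : ℝ) / (n : ℝ))
    * (sMean nA y 1 s - sMean nA y 0 s - tauHat 𝒮 nA y n) ^ 2

/-- Ma et al. (2022) within-stratum variance estimator `V̆_nW(Y)`. -/
def VbreveW (𝒮 : Finset ℕ) (nA : Fin 2 → ℕ → ℕ) (y : Fin 2 → ℕ → ℕ → ℝ) (n : ℕ) : ℝ :=
  ∑ s ∈ 𝒮, ∑ a : Fin 2,
    ((nStr nA s : ℝ) / (n : ℝ)) * ((((nA a s : ℝ) - 1) / (nA a s : ℝ))
      * (((nStr nA s : ℝ) / (nA a s : ℝ)) * sVar nA y a s))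

theorem aux_mu2 (nA : Fin 2 → ℕ → ℕ) (y : Fin 2 → ℕ → ℕ → ℝ) (a : Fin 2) (s : ℕ)
    (h : 2 ≤ nA a s) :
    sMu2 nA y a s - sVar nA y a s = sMean nA y a s ^ 2 - sVar nA y a s / (nA a s : ℝ) := by
  have h2 : (2 : ℝ) ≤ nA a s := by exact_mod_cast h
  have hne : (nA a s : ℝ) ≠ 0 := by linarith
  have hne1 : (nA a s : ℝ) - 1 ≠ 0 := by linarith
  have e1 : ∑ j ∈ Finset.range (nA a s), y a s j = (nA a s : ℝ) * sMean nA y a s := by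
    unfold sMean; field_simp
  have e2 : ∑ j ∈ Finset.range (nA a s), (y a s j) ^ 2 = (nA a s : ℝ) * sMu2 nA y a s := by
    unfold sMu2; field_simp
  have e3 : ∑ j ∈ Finset.range (nA a s), (y a s j - sMean nA y a s) ^ 2
      = ((nA a s : ℝ) - 1) * sVar nA y a s := by
    unfold sVar; field_simp
  have e4 : ∑ j ∈ Finset.range (nA a s), (y a s j - sMean nA y a s) ^ 2
      = ∑ j ∈ Finset.range (nA a s), (y a s j) ^ 2
        - 2 * sMean nA y a s * ∑ j ∈ Finset.range (nA a s), y a s j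
        + (nA a s : ℝ) * sMean nA y a s ^ 2 := by
    simp only [sub_sq, Finset.sum_add_distrib, Finset.sum_sub_distrib, Finset.sum_const,
      Finset.card_range, nsmul_eq_mul, Finset.mul_sum]
    congr 2
    exact Finset.sum_congr rfl fun j _ => by ring
  rw [e1, e2, e3] at e4
  field_simp
  linarith

/-- **exact comparison of variance estimators.** For any realization with
at least two observations in each arm of each stratum, the degrees-of-freedom-adjusted
variance estimator `V̂ = V̂_nB + V̂_nW` exceeds the unadjusted one `V̆ = V̆_nB + V̆_nW`
by the exact nonnegative amount
`∑_s (n(s)/n) {σ̂²(Y,1,s)·n₀(s)/n₁(s)² + σ̂²(Y,0,s)·n₁(s)/n₀(s)²}`. -/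
theorem variance_estimator_comparison
    (𝒮 : Finset ℕ) (nA : Fin 2 → ℕ → ℕ) (y : Fin 2 → ℕ → ℕ → ℝ) (n : ℕ)
    (htwo : ∀ a : Fin 2, ∀ s ∈ 𝒮, 2 ≤ nA a s)
    (hn : (n : ℝ) = ∑ s ∈ 𝒮, (nStr nA s : ℝ)) (hn0 : 0 < n) :
    VhatB 𝒮 nA y n - VbreveB 𝒮 nA y n
        = -∑ s ∈ 𝒮, ((nStr nA s : ℝ) / (n : ℝ))
            * (sVar nA y 1 s / (nA 1 s : ℝ) + sVar nA y 0 s / (nA 0 s : ℝ)) ∧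
    VhatW 𝒮 nA y n - VbreveW 𝒮 nA y n
        = ∑ s ∈ 𝒮, ((nStr nA s : ℝ) / (n : ℝ))
            * (((nStr nA s : ℝ) / (nA 1 s : ℝ)) * (sVar nA y 1 s / (nA 1 s : ℝ))
              + ((nStr nA s : ℝ) / (nA 0 s : ℝ)) * (sVar nA y 0 s / (nA 0 s : ℝ))) ∧
    (VhatB 𝒮 nA y n + VhatW 𝒮 nA y n) - (VbreveB 𝒮 nA y n + VbreveW 𝒮 nA y n)
        = ∑ s ∈ 𝒮, ((nStr nA s : ℝ) / (n : ℝ))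
            * (sVar nA y 1 s * (nA 0 s : ℝ) / ((nA 1 s : ℝ)) ^ 2
              + sVar nA y 0 s * (nA 1 s : ℝ) / ((nA 0 s : ℝ)) ^ 2) ∧
    0 ≤ (VhatB 𝒮 nA y n + VhatW 𝒮 nA y n) - (VbreveB 𝒮 nA y n + VbreveW 𝒮 nA y n) := by
  have hpos : (0 : ℝ) < n := by exact_mod_cast hn0
  have hw : ∑ s ∈ 𝒮, ((nStr nA s : ℝ) / (n : ℝ)) = 1 := by
    rw [← Finset.sum_div, ← hn]; exact div_self hpos.ne'
  have h2 : ∀ a : Fin 2, ∀ s ∈ 𝒮, (2 : ℝ) ≤ nA a s := fun a s hs => by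
    exact_mod_cast htwo a s hs
  have hB : VhatB 𝒮 nA y n - VbreveB 𝒮 nA y n
        = -∑ s ∈ 𝒮, ((nStr nA s : ℝ) / (n : ℝ))
            * (sVar nA y 1 s / (nA 1 s : ℝ) + sVar nA y 0 s / (nA 0 s : ℝ)) := by
    have hb : VbreveB 𝒮 nA y n = ∑ s ∈ 𝒮, ((nStr nA s : ℝ) / (n : ℝ))
        * (sMean nA y 1 s - sMean nA y 0 s) ^ 2 - (tauHat 𝒮 nA y n) ^ 2 := by
      have e : VbreveB 𝒮 nA y n = ∑ s ∈ 𝒮, ((nStr nA s : ℝ) / (n : ℝ))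
          * (sMean nA y 1 s - sMean nA y 0 s) ^ 2
          - 2 * tauHat 𝒮 nA y n * tauHat 𝒮 nA y n
          + (tauHat 𝒮 nA y n) ^ 2 * ∑ s ∈ 𝒮, ((nStr nA s : ℝ) / (n : ℝ)) := by
        conv_rhs => enter [1, 2, 2]; unfold tauHat
        unfold VbreveB
        rw [Finset.mul_sum, Finset.mul_sum, ← Finset.sum_sub_distrib, ← Finset.sum_add_distrib]
        exact Finset.sum_congr rfl fun s _ => by ring
      rw [e, hw]; ring
    have hh : VhatB 𝒮 nA y n = ∑ s ∈ 𝒮, ((nStr nA s : ℝ) / (n : ℝ))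
        * (sMean nA y 1 s - sMean nA y 0 s) ^ 2
        - ∑ s ∈ 𝒮, ((nStr nA s : ℝ) / (n : ℝ))
            * (sVar nA y 1 s / (nA 1 s : ℝ) + sVar nA y 0 s / (nA 0 s : ℝ))
        - (tauHat 𝒮 nA y n) ^ 2 := by
      unfold VhatB
      rw [Finset.mul_sum, ← Finset.sum_sub_distrib, ← Finset.sum_sub_distrib]
      congr 1
      refine Finset.sum_congr rfl fun s hs => ?_
      rw [Fin.sum_univ_two, aux_mu2 nA y 0 s (htwo 0 s hs), aux_mu2 nA y 1 s (htwo 1 s hs)]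
      ring
    rw [hb, hh]; ring
  have hW : VhatW 𝒮 nA y n - VbreveW 𝒮 nA y n
        = ∑ s ∈ 𝒮, ((nStr nA s : ℝ) / (n : ℝ))
            * (((nStr nA s : ℝ) / (nA 1 s : ℝ)) * (sVar nA y 1 s / (nA 1 s : ℝ))
              + ((nStr nA s : ℝ) / (nA 0 s : ℝ)) * (sVar nA y 0 s / (nA 0 s : ℝ))) := by
    unfold VhatW VbreveW
    rw [← Finset.sum_sub_distrib]
    refine Finset.sum_congr rfl fun s hs => ?_
    have h0 : (nA 0 s : ℝ) ≠ 0 := by linarith [h2 0 s hs]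
    have h1 : (nA 1 s : ℝ) ≠ 0 := by linarith [h2 1 s hs]
    rw [Fin.sum_univ_two, Fin.sum_univ_two]
    field_simp
    ring
  have hT : (VhatB 𝒮 nA y n + VhatW 𝒮 nA y n) - (VbreveB 𝒮 nA y n + VbreveW 𝒮 nA y n)
        = ∑ s ∈ 𝒮, ((nStr nA s : ℝ) / (n : ℝ))
            * (sVar nA y 1 s * (nA 0 s : ℝ) / ((nA 1 s : ℝ)) ^ 2
              + sVar nA y 0 s * (nA 1 s : ℝ) / ((nA 0 s : ℝ)) ^ 2) := by
    rw [add_sub_add_comm, hB, hW, ← Finset.sum_neg_distrib, ← Finset.sum_add_distrib]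
    refine Finset.sum_congr rfl fun s hs => ?_
    have h0 : (nA 0 s : ℝ) ≠ 0 := by linarith [h2 0 s hs]
    have h1 : (nA 1 s : ℝ) ≠ 0 := by linarith [h2 1 s hs]
    rw [← mul_neg, ← mul_add]
    congr 1
    have : (nStr nA s : ℝ) = nA 0 s + nA 1 s := by simp [nStr]
    rw [this]
    field_simp
    ring
  refine ⟨hB, hW, hT, ?_⟩
  rw [hT]
  have hv : ∀ a : Fin 2, ∀ s ∈ 𝒮, 0 ≤ sVar nA y a s := fun a s hs => by
    unfold sVar
    exact div_nonneg (Finset.sum_nonneg fun j _ => sq_nonneg _) (by linarith [h2 a s hs])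
  refine Finset.sum_nonneg fun s hs => ?_
  have v0 := hv 0 s hs
  have v1 := hv 1 s hs
  positivity

end VarCompare
end
end

section
/- Hölder–Markov bound for the Lindeberg sum: Let S be a finite index set. For each s∈S let V_s be a real random variable with E(V_s)=0, E(V_s²)=1, and E|V_s|^{2+γ} ≤ M for some γ>0 and M<∞. Let w_s ≥ 0 satisfy Σ_{s∈S} w_s² = 1 and let n_s > 0. Then for every δ>0, Σ_{s∈S} E[ w_s² V_s² · 1{ w_s²V_s² ≥ δ² n_s } ] ≤ (M^{2/(2+γ)} / δ^{2γ/(2+γ)}) · (sup_{s∈S} w_s²/n_s)^{γ/(2+γ)}. -/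
open MeasureTheory Filter

theorem holder_aux {Ω : Type*} {mΩ : MeasurableSpace Ω} (μ : Measure Ω) [IsProbabilityMeasure μ]
    (X : Ω → ℝ) (γ : ℝ) (hγ : 0 < γ) (hX : Measurable X)
    (hint : Integrable (fun ω => |X ω| ^ (2 + γ)) μ) (A : Set Ω) (hA : MeasurableSet A) :
    ∫ ω, X ω ^ 2 * A.indicator (fun _ => (1 : ℝ)) ω ∂μ ≤
      (∫ ω, |X ω| ^ (2 + γ) ∂μ) ^ ((2 : ℝ) / (2 + γ)) * (μ.real A) ^ (γ / (2 + γ)) := by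
  have hp : (0 : ℝ) < 2 + γ := by linarith
  have hpq : ((2 + γ) / 2).HolderConjugate ((2 + γ) / γ) := by
    rw [Real.holderConjugate_iff]
    constructor
    · rw [lt_div_iff₀ (by norm_num)]; linarith
    · field_simp
  have hpow : ∀ ω, (X ω ^ 2) ^ ((2 + γ) / 2) = |X ω| ^ (2 + γ) := by
    intro ω
    rw [← sq_abs, ← Real.rpow_natCast, ← Real.rpow_mul (abs_nonneg _)]
    congr 1
    push_cast
    field_simp
  have hf : MemLp (fun ω => X ω ^ 2) (ENNReal.ofReal ((2 + γ) / 2)) μ := by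
    rw [← integrable_norm_rpow_iff (by fun_prop) (by simp; positivity) (by simp)]
    rw [ENNReal.toReal_ofReal (by positivity)]
    refine hint.congr (ae_of_all _ fun ω => ?_)
    simp only [Real.norm_eq_abs, abs_pow, sq_abs, hpow]
  have hg : MemLp (A.indicator (fun _ => (1 : ℝ))) (ENNReal.ofReal ((2 + γ) / γ)) μ :=
    memLp_indicator_const _ hA _ (Or.inr (measure_ne_top _ _))
  have h := integral_mul_le_Lp_mul_Lq_of_nonneg hpq (μ := μ)
    (ae_of_all _ fun ω => sq_nonneg (X ω))
    (ae_of_all _ fun ω => Set.indicator_nonneg (fun _ _ => zero_le_one) ω) hf hg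
  have hgi : ∀ ω, (A.indicator (fun _ => (1 : ℝ)) ω) ^ ((2 + γ) / γ)
      = A.indicator (fun _ => (1 : ℝ)) ω := by
    intro ω
    by_cases h : ω ∈ A
    · simp [h]
    · simp only [h, not_false_eq_true, Set.indicator_of_notMem]
      exact Real.zero_rpow (by positivity)
  simp only [hpow, hgi, one_div_div] at h
  rwa [integral_indicator_const _ hA, smul_eq_mul, mul_one] at h

/-- **Hölder–Markov bound for the Lindeberg sum.** Let `S` be a finite
(nonempty) index set.  For each `s` let `V s` be a real random variable with mean `0`,
second moment `1`, and `E|V s|^{2+γ} ≤ M` for some `γ > 0`.  Let `w s ≥ 0` satisfy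
`∑ s, (w s)² = 1` and let `ns s > 0`.  Then for every `δ > 0`,
`∑ s, E[(w s)²(V s)² · 1{(w s)²(V s)² ≥ δ² ns s}]
  ≤ (M^{2/(2+γ)} / δ^{2γ/(2+γ)}) · (sup_s (w s)²/ns s)^{γ/(2+γ)}`. -/
theorem lindeberg_holder_markov_bound
    {Ω : Type*} {mΩ : MeasurableSpace Ω} (μ : Measure Ω) [IsProbabilityMeasure μ]
    {ι : Type*} [Fintype ι] [Nonempty ι]
    (V : ι → Ω → ℝ) (w ns : ι → ℝ) (γ M : ℝ) (hγ : 0 < γ)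
    (hmeas : ∀ s, Measurable (V s))
    (hint : ∀ s, Integrable (fun ω => |V s ω| ^ (2 + γ)) μ)
    (hmean : ∀ s, ∫ ω, V s ω ∂μ = 0)
    (hsecond : ∀ s, ∫ ω, (V s ω) ^ 2 ∂μ = 1)
    (hmom : ∀ s, ∫ ω, |V s ω| ^ (2 + γ) ∂μ ≤ M)
    (hw : ∀ s, 0 ≤ w s) (hw2 : ∑ s, (w s) ^ 2 = 1)
    (hns : ∀ s, 0 < ns s)
    (δ : ℝ) (hδ : 0 < δ) :
    ∑ s, ∫ ω, Set.indicator {ω' | δ ^ 2 * ns s ≤ (w s) ^ 2 * (V s ω') ^ 2}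
        (fun ω' => (w s) ^ 2 * (V s ω') ^ 2) ω ∂μ
      ≤ (M ^ ((2 : ℝ) / (2 + γ)) / δ ^ (2 * γ / (2 + γ)))
          * (⨆ s, (w s) ^ 2 / ns s) ^ (γ / (2 + γ)) := by
  have hp : (0 : ℝ) < 2 + γ := by linarith
  set K := ⨆ s, (w s) ^ 2 / ns s with hK
  have hle : ∀ s, (w s) ^ 2 / ns s ≤ K := fun s =>
    le_ciSup (f := fun s => (w s) ^ 2 / ns s) (Set.finite_range _).bddAbove s
  have hK0 : 0 ≤ K := by
    obtain ⟨s⟩ := ‹Nonempty ι›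
    exact le_trans (div_nonneg (sq_nonneg _) (hns s).le) (hle s)
  have hδe : δ ^ (2 * γ / (2 + γ)) = (δ ^ 2) ^ (γ / (2 + γ)) := by
    rw [← Real.rpow_natCast, ← Real.rpow_mul hδ.le]
    congr 1
    push_cast
    ring
  have key : ∀ s, ∫ ω, Set.indicator {ω' | δ ^ 2 * ns s ≤ (w s) ^ 2 * (V s ω') ^ 2}
        (fun ω' => (w s) ^ 2 * (V s ω') ^ 2) ω ∂μ
      ≤ (w s) ^ 2 * ((M ^ ((2 : ℝ) / (2 + γ)) / δ ^ (2 * γ / (2 + γ)))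
          * K ^ (γ / (2 + γ))) := by
    intro s
    set A := {ω' | δ ^ 2 * ns s ≤ (w s) ^ 2 * (V s ω') ^ 2} with hAdef
    have hm := hmeas s
    have hA : MeasurableSet A := measurableSet_le (by fun_prop) (by fun_prop)
    have hsq : Integrable (fun ω => (V s ω) ^ 2) μ := by
      by_contra h
      have := hsecond s
      rw [integral_undef h] at this
      norm_num at this
    have hmark := mul_meas_ge_le_integral_of_nonneg (μ := μ)
      (f := fun ω => (w s) ^ 2 * (V s ω) ^ 2)
      (ae_of_all _ fun ω => by positivity) (hsq.const_mul _) (δ ^ 2 * ns s)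
    rw [integral_const_mul, hsecond s, mul_one] at hmark
    have hn := hns s
    have hPA : μ.real A ≤ K / δ ^ 2 := by
      have h1 := hle s
      rw [div_le_iff₀ hn] at h1
      rw [le_div_iff₀ (by positivity)]
      have h2 : δ ^ 2 * ns s * μ.real A ≤ K * ns s := hmark.trans h1
      nlinarith
    have h := holder_aux μ (V s) γ hγ hm (hint s) A hA
    have h0 : 0 ≤ ∫ ω, |V s ω| ^ (2 + γ) ∂μ := integral_nonneg fun ω => by positivity
    have heq : ∫ ω, A.indicator (fun ω' => (w s) ^ 2 * (V s ω') ^ 2) ω ∂μ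
        = (w s) ^ 2 * ∫ ω, V s ω ^ 2 * A.indicator (fun _ => (1 : ℝ)) ω ∂μ := by
      rw [← integral_const_mul]
      congr 1
      ext ω
      by_cases h : ω ∈ A <;> simp [h]
    rw [heq]
    refine mul_le_mul_of_nonneg_left (h.trans ?_) (sq_nonneg _)
    have hM0 : 0 ≤ M := h0.trans (hmom s)
    calc _ ≤ M ^ ((2 : ℝ) / (2 + γ)) * (K / δ ^ 2) ^ (γ / (2 + γ)) :=
          mul_le_mul (Real.rpow_le_rpow h0 (hmom s) (by positivity))
            (Real.rpow_le_rpow measureReal_nonneg hPA (by positivity))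
            (Real.rpow_nonneg measureReal_nonneg _) (Real.rpow_nonneg hM0 _)
      _ = _ := by
          rw [Real.div_rpow hK0 (by positivity), hδe]
          ring
  refine (Finset.sum_le_sum fun s _ => key s).trans ?_
  rw [← Finset.sum_mul, hw2, one_mul]
end

section
/- For n ≥ 1, let U_n and V_n be real-valued random variables and 𝓕_n the σ-field generated by a random vector Y_n. Suppose that for every u∈ℝ, P(U_n ≤ u | 𝓕_n) → Φ(u/τ₁) in probability, that V_n is 𝓕_n-measurable, and that P(V_n ≤ u) → Φ(u/τ₂) for every u∈ℝ, where τ₁, τ₂ are positive constants. Then P(U_n + V_n ≤ u) → Φ(u/√(τ₁² + τ₂²)) for every u∈ℝ. -/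
open MeasureTheory ProbabilityTheory Filter
open scoped ENNReal

lemma aux_rect (ν : Measure (ℝ × ℝ)) [IsFiniteMeasure ν] {a b c d : ℝ} (hab : a < b) (hcd : c < d) :
    ν.real (Set.Ioc a b ×ˢ Set.Ioc c d) =
      (ν.real (Set.Iic b ×ˢ Set.Iic d) - ν.real (Set.Iic a ×ˢ Set.Iic d))
      - (ν.real (Set.Iic b ×ˢ Set.Iic c) - ν.real (Set.Iic a ×ˢ Set.Iic c)) := by
  have h1 : ∀ d, ν.real (Set.Iic b ×ˢ Set.Iic d) - ν.real (Set.Iic a ×ˢ Set.Iic d)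
      = ν.real (Set.Ioc a b ×ˢ Set.Iic d) := by
    intro d
    rw [← measureReal_sdiff (Set.prod_mono (Set.Iic_subset_Iic.2 hab.le) subset_rfl)
      (measurableSet_Iic.prod measurableSet_Iic)]
    congr 1
    ext ⟨x, y⟩
    simp only [Set.mem_sdiff, Set.mem_prod, Set.mem_Iic, Set.mem_Ioc, ← not_le]
    tauto
  rw [h1, h1, ← measureReal_sdiff (Set.prod_mono subset_rfl (Set.Iic_subset_Iic.2 hcd.le))
      (measurableSet_Ioc.prod measurableSet_Iic)]
  congr 1
  ext ⟨x, y⟩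
  simp only [Set.mem_sdiff, Set.mem_prod, Set.mem_Iic, Set.mem_Ioc, ← not_le]
  tauto

lemma aux_cdf (τ : ℝ) (hτ : 0 < τ) (u : ℝ) :
    cdf (gaussianReal 0 1) (u / τ) = (gaussianReal 0 (NNReal.mk (τ ^ 2) (sq_nonneg τ))).real (Set.Iic u) := by
  have h := gaussianReal_map_const_mul (μ := 0) (v := 1) τ
  rw [mul_zero, mul_one] at h
  rw [cdf_eq_real, ← h, map_measureReal_apply (by fun_prop) measurableSet_Iic]
  congr 1
  ext x
  simp only [Set.mem_Iic, Set.mem_preimage]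
  rw [le_div_iff₀ hτ, mul_comm]

lemma aux_bound {Ω : Type*} (F : MeasurableSpace Ω) {mΩ : MeasurableSpace Ω} (μ : Measure Ω) [IsProbabilityMeasure μ]
    (hF : F ≤ mΩ) (A B : Set Ω) (hA : MeasurableSet A)
    (hB : MeasurableSet[F] B) (c : ℝ) (hc0 : 0 ≤ c) (hc1 : c ≤ 1) (ε : ℝ) (hε : 0 < ε) :
    |μ.real (A ∩ B) - c * μ.real B| ≤
      ε + μ.real {ω | ε ≤ |(μ[Set.indicator A (fun _ => (1 : ℝ)) | F]) ω - c|} := by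
  set g := μ[Set.indicator A (fun _ => (1 : ℝ)) | F] with hg
  have hint : Integrable (Set.indicator A (fun _ => (1 : ℝ))) μ :=
    (integrable_const 1).indicator hA
  have hgint : Integrable g μ := integrable_condExp
  have hgm : Measurable g := (stronglyMeasurable_condExp.mono hF).measurable
  have hg0 : 0 ≤ᵐ[μ] g := condExp_nonneg (Eventually.of_forall fun ω =>
    Set.indicator_nonneg (fun _ _ => zero_le_one) ω)
  have hg1 : g ≤ᵐ[μ] fun _ => 1 := by
    have := condExp_mono (m := F) hint (integrable_const (1 : ℝ)) (Eventually.of_forall fun ω =>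
      Set.indicator_le_self' (fun _ _ => zero_le_one) ω)
    rwa [condExp_const hF] at this
  have hD : MeasurableSet {ω | ε ≤ |g ω - c|} :=
    measurableSet_le measurable_const (hgm.sub_const c).abs
  have e1 : μ.real (A ∩ B) - c * μ.real B = ∫ ω in B, (g ω - c) ∂μ := by
    rw [integral_sub hgint.integrableOn (integrable_const c), hg, setIntegral_condExp hF hint hB,
      integral_indicator hA]
    simp [Measure.restrict_restrict hA, mul_comm]
  rw [e1]
  calc |∫ ω in B, (g ω - c) ∂μ| ≤ ∫ ω in B, |g ω - c| ∂μ := abs_integral_le_integral_abs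
    _ ≤ ∫ ω, |g ω - c| ∂μ := setIntegral_le_integral (hgint.sub (integrable_const c)).abs
        (Eventually.of_forall fun _ => abs_nonneg _)
    _ ≤ ∫ ω, (ε + Set.indicator {ω | ε ≤ |g ω - c|} (fun _ => (1 : ℝ)) ω) ∂μ := by
        refine integral_mono_ae (hgint.sub (integrable_const c)).abs
          ((integrable_const ε).add ((integrable_const 1).indicator hD)) ?_
        filter_upwards [hg0, hg1] with ω h0 h1
        by_cases h : ε ≤ |g ω - c|
        · rw [Set.indicator_of_mem (by exact h)]
          have h0' : 0 ≤ g ω := h0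
          have : |g ω - c| ≤ 1 := abs_le.2 ⟨by linarith, by linarith⟩
          linarith
        · rw [Set.indicator_of_notMem (by exact h)]
          linarith
    _ = _ := by
        rw [integral_add (integrable_const ε) ((integrable_const 1).indicator hD),
          integral_indicator hD]
        simp

/-- For `n ≥ 1` let `U n`, `V n` be real random variables and
`𝓕 n` the σ-field generated by a random vector `Y n`.  If `P(U n ≤ u | 𝓕 n) → Φ(u/τ₁)`
in probability for every `u`, `V n` is `𝓕 n`-measurable, and `P(V n ≤ u) → Φ(u/τ₂)` for
every `u`, then `P(U n + V n ≤ u) → Φ(u/√(τ₁² + τ₂²))` for every `u`.  Here `Φ` is the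
standard normal c.d.f. -/
theorem conditional_plus_measurable_clt
    {Ω : Type*} {mΩ : MeasurableSpace Ω} (μ : Measure Ω) [IsProbabilityMeasure μ]
    (U V : ℕ → Ω → ℝ) (Y : ℕ → Ω → (ℕ → ℝ)) (hY : ∀ n, Measurable (Y n))
    (𝓕 : ℕ → MeasurableSpace Ω)
    (h𝓕 : ∀ n, 𝓕 n = MeasurableSpace.comap (Y n) inferInstance)
    (hU : ∀ n, Measurable (U n))
    (hV : ∀ n, @Measurable Ω ℝ (𝓕 n) _ (V n))
    (τ₁ τ₂ : ℝ) (hτ₁ : 0 < τ₁) (hτ₂ : 0 < τ₂)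
    (hUc : ∀ u : ℝ, ∀ ε > (0 : ℝ),
      Tendsto
        (fun n => μ {ω | ε ≤
          |(μ[Set.indicator {ω' | U n ω' ≤ u} (fun _ => (1 : ℝ)) | 𝓕 n]) ω
            - cdf (gaussianReal 0 1) (u / τ₁)|})
        atTop (nhds 0))
    (hVc : ∀ u : ℝ,
      Tendsto (fun n => (μ {ω | V n ω ≤ u}).toReal) atTop
        (nhds (cdf (gaussianReal 0 1) (u / τ₂)))) :
    ∀ u : ℝ,
      Tendsto (fun n => (μ {ω | U n ω + V n ω ≤ u}).toReal) atTop
        (nhds (cdf (gaussianReal 0 1) (u / Real.sqrt (τ₁ ^ 2 + τ₂ ^ 2)))) := by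
  have hF : ∀ n, 𝓕 n ≤ mΩ := fun n => by rw [h𝓕 n]; exact (hY n).comap_le
  have hV' : ∀ n, Measurable (V n) := fun n => (hV n).mono (hF n) le_rfl
  -- joint cdf convergence
  have key : ∀ a b : ℝ, Tendsto (fun n => μ.real ({ω | U n ω ≤ a} ∩ {ω | V n ω ≤ b})) atTop
      (nhds (cdf (gaussianReal 0 1) (a / τ₁) * cdf (gaussianReal 0 1) (b / τ₂))) := by
    intro a b
    set c := cdf (gaussianReal 0 1) (a / τ₁) with hc
    have h1 : Tendsto (fun n => c * μ.real {ω | V n ω ≤ b}) atTop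
      (nhds (c * cdf (gaussianReal 0 1) (b / τ₂))) := (hVc b).const_mul c
    have h2 : Tendsto (fun n => μ.real ({ω | U n ω ≤ a} ∩ {ω | V n ω ≤ b})
        - c * μ.real {ω | V n ω ≤ b}) atTop (nhds 0) := by
      rw [Metric.tendsto_atTop']
      intro ε hε
      have h3 := (ENNReal.tendsto_toReal ENNReal.zero_ne_top).comp (hUc a (ε / 2) (half_pos hε))
      have h4 := (tendsto_order.1 h3).2 (ε / 2) (by simpa using half_pos hε)
      obtain ⟨N, hN⟩ := eventually_atTop.1 h4
      refine ⟨N, fun n hn => ?_⟩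
      have h5 := aux_bound (𝓕 n) μ (hF n) {ω | U n ω ≤ a} {ω | V n ω ≤ b}
        (measurableSet_le (hU n) measurable_const) (hV n measurableSet_Iic) c
        (cdf_nonneg _ _) (cdf_le_one _ _) (ε / 2) (half_pos hε)
      have h6 := hN n hn.le
      simp only [Function.comp, ← measureReal_def] at h6
      rw [Real.dist_eq, sub_zero]
      linarith
    simpa using h2.add h1
  set g₁ := gaussianReal 0 (NNReal.mk (τ₁ ^ 2) (sq_nonneg τ₁)) with hg₁
  set g₂ := gaussianReal 0 (NNReal.mk (τ₂ ^ 2) (sq_nonneg τ₂)) with hg₂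
  have hprob : ∀ n, IsProbabilityMeasure (μ.map (fun ω => (U n ω, V n ω))) := fun n =>
    Measure.isProbabilityMeasure_map ((hU n).prodMk (hV' n)).aemeasurable
  let P : ℕ → ProbabilityMeasure (ℝ × ℝ) := fun n => ⟨μ.map (fun ω => (U n ω, V n ω)), hprob n⟩
  let Q : ProbabilityMeasure (ℝ × ℝ) := ⟨g₁.prod g₂, inferInstance⟩
  have hP : ∀ a b : ℝ, Tendsto (fun n => (P n : Measure (ℝ × ℝ)).real (Set.Iic a ×ˢ Set.Iic b))
      atTop (nhds ((Q : Measure (ℝ × ℝ)).real (Set.Iic a ×ˢ Set.Iic b))) := by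
    intro a b
    have h := key a b
    rw [aux_cdf τ₁ hτ₁, aux_cdf τ₂ hτ₂] at h
    have e : (Q : Measure (ℝ × ℝ)).real (Set.Iic a ×ˢ Set.Iic b)
      = g₁.real (Set.Iic a) * g₂.real (Set.Iic b) := measureReal_prod_prod _ _
    rw [e]
    refine h.congr fun n => ?_
    exact (map_measureReal_apply ((hU n).prodMk (hV' n))
      (measurableSet_Iic.prod measurableSet_Iic)).symm
  have hPQ : Tendsto P atTop (nhds Q) := by
    refine IsPiSystem.tendsto_probabilityMeasure_of_tendsto_of_mem
      ((isPiSystem_Ioc_mem (Set.univ : Set ℝ) Set.univ).prod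
        (isPiSystem_Ioc_mem (Set.univ : Set ℝ) Set.univ)) ?_ ?_ ?_
    · rintro _ ⟨_, ⟨a, -, b, -, hab, rfl⟩, _, ⟨c, -, d, -, hcd, rfl⟩, rfl⟩
      exact measurableSet_Ioc.prod measurableSet_Ioc
    · rintro u hu ⟨x, y⟩ hx
      obtain ⟨ε, hε, hb⟩ := Metric.isOpen_iff.1 hu _ hx
      refine ⟨Set.Ioc (x - ε / 2) (x + ε / 2) ×ˢ Set.Ioc (y - ε / 2) (y + ε / 2),
        ⟨_, ⟨_, trivial, _, trivial, by linarith, rfl⟩, _, ⟨_, trivial, _, trivial, by linarith, rfl⟩,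
          rfl⟩, prod_mem_nhds (Ioc_mem_nhds (by linarith) (by linarith))
            (Ioc_mem_nhds (by linarith) (by linarith)), ?_⟩
      rintro ⟨z, w⟩ ⟨⟨h1, h2⟩, h3, h4⟩
      apply hb
      simp only at h1 h2 h3 h4
      rw [Metric.mem_ball, Prod.dist_eq, max_lt_iff, Real.dist_eq, Real.dist_eq, abs_lt, abs_lt]
      refine ⟨⟨?_, ?_⟩, ?_, ?_⟩ <;> simp only <;> linarith
    · rintro _ ⟨_, ⟨a, -, b, -, hab, rfl⟩, _, ⟨c, -, d, -, hcd, rfl⟩, rfl⟩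
      have h : Tendsto (fun n => (P n : Measure (ℝ × ℝ)).real (Set.Ioc a b ×ˢ Set.Ioc c d))
          atTop (nhds ((Q : Measure (ℝ × ℝ)).real (Set.Ioc a b ×ˢ Set.Ioc c d))) := by
        simp only [aux_rect _ hab hcd]
        exact ((hP _ _).sub (hP _ _)).sub ((hP _ _).sub (hP _ _))
      simpa using h
  have hmap := ProbabilityMeasure.tendsto_map_of_tendsto_of_continuous P Q hPQ
    (f := fun p : ℝ × ℝ => p.1 + p.2) (by fun_prop)
  intro u
  set s := Real.sqrt (τ₁ ^ 2 + τ₂ ^ 2) with hs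
  have hspos : 0 < s := Real.sqrt_pos.2 (by positivity)
  have hconv : (g₁.prod g₂).map (fun p : ℝ × ℝ => p.1 + p.2)
      = gaussianReal 0 (NNReal.mk (s ^ 2) (sq_nonneg s)) := by
    have := gaussianReal_conv_gaussianReal (m₁ := 0) (m₂ := 0) (v₁ := (NNReal.mk (τ₁ ^ 2) (sq_nonneg τ₁)))
      (v₂ := (NNReal.mk (τ₂ ^ 2) (sq_nonneg τ₂)))
    rw [Measure.conv] at this
    rw [hg₁, hg₂, this, add_zero]
    congr 1
    ext
    exact (Real.sq_sqrt (by positivity)).symm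
  have hlim := ProbabilityMeasure.tendsto_measure_of_null_frontier_of_tendsto' hmap
    (E := Set.Iic u) (by
      have hv : ((NNReal.mk (s ^ 2) (sq_nonneg s)) : NNReal) ≠ 0 := by
        intro h
        have := congrArg NNReal.toReal h
        exact (pow_pos hspos 2).ne' this
      have := nullSingletonClass_gaussianReal (μ := 0) hv
      rw [frontier_Iic]
      show ((g₁.prod g₂).map (fun p : ℝ × ℝ => p.1 + p.2)) {u} = 0
      rw [hconv]
      exact measure_singleton u)
  have hlim' := (ENNReal.tendsto_toReal (measure_ne_top _ _)).comp hlim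
  rw [aux_cdf s hspos, ← hconv]
  refine hlim'.congr fun n => ?_
  show (((μ.map (fun ω => (U n ω, V n ω))).map (fun p : ℝ × ℝ => p.1 + p.2)) (Set.Iic u)).toReal = _
  rw [Measure.map_map (by fun_prop) ((hU n).prodMk (hV' n)),
    Measure.map_apply (by exact (hU n).add (hV' n)) measurableSet_Iic]
  rfl
end
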